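/- arXiv:1811.05428 — 2 statements merged into one kernel-verified Lean document; each statement's English description precedes it below -/
import Mathlib

section
/- The multiplication operator M_z on the Dirichlet space is not Möbius bounded: there is no constant c > 0 such that for every θ ∈ [0,2π), every a ∈ 𝔻 and every f in the Dirichlet space, the product φ_{θ,a}·f belongs to the Dirichlet space with ‖φ_{θ,a} f‖ ≤ c ‖f‖. -/
open Metric

/-- The Möbius transformation `φ_{θ,a}(z) = e^{iθ} (z − a)/(1 − ā z)`. -/
noncomputable def mobius (θ : ℝ) (a z : ℂ) : ℂ :=
  Complex.exp (θ * Complex.I) * (z - a) / (1 - (starRingEnd ℂ) a * z)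

/-- The multiplication operator `M_z` on the weighted Hardy space `H(b)` (with
`‖Σ αₙ zⁿ‖² = Σ |αₙ|²/bₙ`) is Möbius bounded: there is a single constant `c > 0` bounding the
norm of the multiplication operator `M_{φ_{θ,a}}` on `H(b)` for every `φ_{θ,a} ∈ Möb`. -/
def MobiusBounded (b : ℕ → ℝ) : Prop :=
  ∃ c : ℝ, 0 < c ∧ ∀ θ ∈ Set.Ico (0 : ℝ) (2 * Real.pi), ∀ a ∈ ball (0 : ℂ) 1,
    ∀ (f : ℂ → ℂ) (α : ℕ → ℂ),
      (∀ z ∈ ball (0 : ℂ) 1, HasSum (fun n => α n * z ^ n) (f z)) →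
      Summable (fun n => ‖α n‖ ^ 2 / b n) →
      ∃ β : ℕ → ℂ,
        (∀ z ∈ ball (0 : ℂ) 1, HasSum (fun n => β n * z ^ n) (mobius θ a z * f z)) ∧
        Summable (fun n => ‖β n‖ ^ 2 / b n) ∧
        ∑' n, ‖β n‖ ^ 2 / b n ≤ c ^ 2 * ∑' n, ‖α n‖ ^ 2 / b n

/-- The Taylor coefficients at `0` of `z ↦ (z - a) / (1 - a z)` for real `a`. -/
noncomputable def mobiusCoeff (a : ℝ) : ℕ → ℝ
  | 0 => -a
  | m + 1 => (1 - a ^ 2) * a ^ m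

theorem hasSum_mobiusCoeff {a : ℝ} (ha0 : 0 ≤ a) (ha1 : a < 1) {z : ℂ} (hz : ‖z‖ < 1) :
    HasSum (fun n => (mobiusCoeff a n : ℂ) * z ^ n) (mobius 0 a z) := by
  have hnorm : ‖(a : ℂ) * z‖ < 1 := by
    rw [norm_mul, Complex.norm_real, Real.norm_of_nonneg ha0]
    nlinarith [norm_nonneg z]
  have hne : 1 - (a : ℂ) * z ≠ 0 := by
    intro h
    rw [← sub_eq_zero.mp h] at hnorm
    simp at hnorm
  rw [← hasSum_nat_add_iff' 1]
  convert (hasSum_geometric_of_norm_lt_one hnorm).mul_left ((1 - (a : ℂ) ^ 2) * z) using 1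
  · rfl
  · funext n
    simp only [mobiusCoeff]
    push_cast
    ring
  · simp only [mobius, mobiusCoeff, Finset.sum_range_one, Complex.conj_ofReal,
      Complex.ofReal_zero, zero_mul, Complex.exp_zero, one_mul, pow_zero, mul_one,
      Complex.ofReal_neg, div_eq_mul_inv]
    linear_combination (-(a : ℂ)) * mul_inv_cancel₀ hne

theorem hasSum_pow_mul_shift {p : ℕ → ℂ} {z s : ℂ} (h : HasSum (fun n => p n * z ^ n) s) (k : ℕ) :
    HasSum (fun n => (if n < k then 0 else p (n - k)) * z ^ n) (z ^ k * s) := by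
  rw [← hasSum_nat_add_iff' k]
  have hzero : ∑ i ∈ Finset.range k, (if i < k then 0 else p (i - k)) * z ^ i = 0 :=
    Finset.sum_eq_zero fun i hi => by simp [Finset.mem_range.mp hi]
  rw [hzero, sub_zero]
  convert h.mul_left (z ^ k) using 1
  · rfl
  · funext n
    simp only [add_tsub_cancel_right, if_neg (not_lt.mpr (Nat.le_add_left k n))]
    ring

theorem coeff_eq_of_hasSum_ball {f : ℂ → ℂ} {β γ : ℕ → ℂ}
    (hβ : ∀ z ∈ ball (0 : ℂ) 1, HasSum (fun n => β n * z ^ n) (f z))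
    (hγ : ∀ z ∈ ball (0 : ℂ) 1, HasSum (fun n => γ n * z ^ n) (f z)) : β = γ := by
  have key : ∀ δ : ℕ → ℂ, (∀ z ∈ ball (0 : ℂ) 1, HasSum (fun n => δ n * z ^ n) (f z)) →
      HasFPowerSeriesAt f (FormalMultilinearSeries.ofScalars ℂ δ) 0 := by
    intro δ hδ
    rw [hasFPowerSeriesAt_iff]
    filter_upwards [ball_mem_nhds (0 : ℂ) one_pos] with z hz
    simpa [FormalMultilinearSeries.coeff_ofScalars, mul_comm] using hδ z hz
  have h := (key β hβ).eq_formalMultilinearSeries (key γ hγ)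
  funext n
  simpa [FormalMultilinearSeries.coeff_ofScalars] using
    congrArg (fun p : FormalMultilinearSeries ℂ ℂ ℂ => p.coeff n) h

/-- The Taylor coefficients of `φ_{0,a} · ∑_{k<N} z^k / (k+1)`. -/
noncomputable def mobiusMulCoeff (a : ℝ) (N n : ℕ) : ℝ :=
  ∑ k ∈ Finset.range N, 1 / ((k : ℝ) + 1) * (if n < k then 0 else mobiusCoeff a (n - k))

theorem hasSum_mobiusMulCoeff {a : ℝ} (ha0 : 0 ≤ a) (ha1 : a < 1) (N : ℕ) {z : ℂ}
    (hz : ‖z‖ < 1) :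
    HasSum (fun n => (mobiusMulCoeff a N n : ℂ) * z ^ n)
      (mobius 0 a z * ∑ k ∈ Finset.range N, ((1 / ((k : ℝ) + 1) : ℝ) : ℂ) * z ^ k) := by
  have h := hasSum_sum (s := Finset.range N) fun k _ =>
    (hasSum_pow_mul_shift (hasSum_mobiusCoeff ha0 ha1 hz) k).mul_left
      ((1 / ((k : ℝ) + 1) : ℝ) : ℂ)
  convert h using 1
  · rfl
  · funext n
    rw [mobiusMulCoeff, Complex.ofReal_sum, Finset.sum_mul]
    refine Finset.sum_congr rfl fun k _ => ?_
    split_ifs <;> push_cast <;> ring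
  · rw [Finset.mul_sum]
    exact Finset.sum_congr rfl fun k _ => by ring

theorem le_mobiusMulCoeff {N n : ℕ} (hN : 0 < N) (hn : N ≤ n) (hn2 : n ≤ 2 * N) :
    (∑ k ∈ Finset.range N, 1 / ((k : ℝ) + 1)) / (8 * N) ≤
      mobiusMulCoeff (1 - 1 / (4 * N)) N n := by
  have hN1 : (1 : ℝ) ≤ N := by exact_mod_cast hN
  set e : ℝ := 1 / (4 * N) with he
  have heN : e * (4 * N) = 1 := by rw [he]; field_simp
  have he0 : 0 < e := by positivity
  have he1 : e ≤ 1 / 4 := by nlinarith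
  rw [mobiusMulCoeff, Finset.sum_div]
  refine Finset.sum_le_sum fun k hk => ?_
  have hkn : k < n := (Finset.mem_range.mp hk).trans_le hn
  obtain ⟨m, rfl⟩ := Nat.exists_eq_add_of_lt hkn
  rw [if_neg (by omega), show k + m + 1 - k = m + 1 by omega, mobiusCoeff, div_eq_mul_one_div]
  refine mul_le_mul_of_nonneg_left ?_ (by positivity)
  have hm : (m : ℝ) ≤ 2 * N := by exact_mod_cast (show m ≤ 2 * N by omega)
  have hpow : 1 / 2 ≤ (1 - e) ^ m := by
    have := one_add_mul_le_pow (show (-2 : ℝ) ≤ -e by linarith) m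
    rw [← sub_eq_add_neg 1 e] at this
    nlinarith
  have h8 : 1 / (8 * (N : ℝ)) = e * (1 / 2) := by rw [he]; field_simp; norm_num
  rw [h8]
  exact mul_le_mul (by nlinarith) hpow (by norm_num) (by nlinarith)

/-- The multiplication operator `M_z` on the Dirichlet space (the weighted
Hardy space with `bₙ = 1/(n+1)`, i.e. `‖Σ αₙ zⁿ‖² = Σ (n+1)|αₙ|²`) is not Möbius bounded. -/
theorem stmt_12 : ¬ MobiusBounded (fun n : ℕ => ((n : ℝ) + 1)⁻¹) := by
  rintro ⟨c, hc, h⟩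
  obtain ⟨N, hlarge, hN⟩ :=
    ((Real.tendsto_sum_range_one_div_nat_succ_atTop.eventually_gt_atTop (64 * c ^ 2)).and
      (Filter.eventually_gt_atTop 0)).exists
  set H : ℝ := ∑ k ∈ Finset.range N, 1 / ((k : ℝ) + 1) with hH
  have hN1 : (1 : ℝ) ≤ N := by exact_mod_cast hN
  have hH0 : 0 < H := lt_of_le_of_lt (by positivity) hlarge
  set a : ℝ := 1 - 1 / (4 * N) with ha
  have hfrac : 1 / (4 * (N : ℝ)) ≤ 1 := by
    rw [div_le_one (by positivity)]
    linarith
  have ha0 : 0 ≤ a := by linarith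
  have ha1 : a < 1 := by
    have : 0 < 1 / (4 * (N : ℝ)) := by positivity
    linarith
  let α : ℕ → ℂ := fun k => if k < N then ((1 / ((k : ℝ) + 1) : ℝ) : ℂ) else 0
  have hα_norm : HasSum (fun n => ‖α n‖ ^ 2 / ((n : ℝ) + 1)⁻¹) H := by
    have hsum : ∑ n ∈ Finset.range N, ‖α n‖ ^ 2 / ((n : ℝ) + 1)⁻¹ = H := by
      refine Finset.sum_congr rfl fun k hk => ?_
      have hk' : (0 : ℝ) < k + 1 := by positivity
      simp only [α, if_pos (Finset.mem_range.mp hk), Complex.norm_real, Real.norm_eq_abs, sq_abs]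
      field_simp
    rw [← hsum]
    exact hasSum_sum_of_ne_finset_zero fun k hk => by
      simp only [α, if_neg (fun hlt => hk (Finset.mem_range.mpr hlt))]
      simp
  obtain ⟨β, hβ, hβs, hβle⟩ := h 0 ⟨le_rfl, by positivity⟩ a
    (by rwa [mem_ball_zero_iff, Complex.norm_real, Real.norm_of_nonneg ha0])
    (fun z => ∑ k ∈ Finset.range N, ((1 / ((k : ℝ) + 1) : ℝ) : ℂ) * z ^ k) α
    (fun z _ => by
      have hsum : ∑ k ∈ Finset.range N, ((1 / ((k : ℝ) + 1) : ℝ) : ℂ) * z ^ k =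
          ∑ k ∈ Finset.range N, α k * z ^ k :=
        Finset.sum_congr rfl fun k hk => by simp only [α, if_pos (Finset.mem_range.mp hk)]
      simp only [hsum]
      exact hasSum_sum_of_ne_finset_zero fun k hk => by
        simp only [α, if_neg (fun hlt => hk (Finset.mem_range.mpr hlt)), zero_mul])
    hα_norm.summable
  have hβγ : β = fun n => (mobiusMulCoeff a N n : ℂ) :=
    coeff_eq_of_hasSum_ball hβ fun z hz =>
      hasSum_mobiusMulCoeff ha0 ha1 N (mem_ball_zero_iff.mp hz)
  rw [hα_norm.tsum_eq] at hβle
  have hterm : ∀ n ∈ Finset.Ico N (2 * N), H ^ 2 / (64 * N) ≤ ‖β n‖ ^ 2 / ((n : ℝ) + 1)⁻¹ := by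
    intro n hn
    obtain ⟨hNn, hn2⟩ := Finset.mem_Ico.mp hn
    have hle := le_mobiusMulCoeff hN hNn hn2.le
    have hNn' : (N : ℝ) ≤ n + 1 := by exact_mod_cast hNn.trans n.le_succ
    rw [hβγ, Complex.norm_real, Real.norm_eq_abs, sq_abs, div_inv_eq_mul]
    calc H ^ 2 / (64 * N) = (H / (8 * N)) ^ 2 * N := by field_simp; norm_num
      _ ≤ _ := mul_le_mul (pow_le_pow_left₀ (by positivity) hle 2) hNn' (by positivity)
        (by positivity)
  have hlow : H ^ 2 / 64 ≤ ∑' n, ‖β n‖ ^ 2 / ((n : ℝ) + 1)⁻¹ := by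
    refine le_trans ?_ (hβs.sum_le_tsum (Finset.Ico N (2 * N)) fun n _ => by positivity)
    refine le_trans (le_of_eq ?_) (Finset.card_nsmul_le_sum _ _ _ hterm)
    rw [Nat.card_Ico, show 2 * N - N = N by omega, nsmul_eq_mul]
    field_simp
  nlinarith [hlow.trans hβle]
end

section
/- Let λ > 0 and a ∈ 𝔻. Then the function z ↦ (1−ā z)^{−2} is a multiplier of H^{(λ)}: there exists a constant C > 0 such that for every f ∈ H^{(λ)}, the function z ↦ (1−ā z)^{−2} f(z) belongs to H^{(λ)} and ‖(1−ā z)^{−2} f‖_{H^{(λ)}} ≤ C ‖f‖_{H^{(λ)}}. -/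
open Metric

/-- The Pochhammer symbol `(l)ₙ = l (l+1) ⋯ (l+n−1)`. -/
noncomputable def poch (l : ℝ) (n : ℕ) : ℝ := ∏ i ∈ Finset.range n, (l + i)

/-- The weight `n! / (l)ₙ`, i.e. `‖zⁿ‖²` in the space `H^{(l)}` with kernel `(1 - z w̄)^{-l}`. -/
noncomputable def wt (l : ℝ) (n : ℕ) : ℝ := (Nat.factorial n : ℝ) / poch l n

lemma poch_pos {l : ℝ} (hl : 0 < l) (n : ℕ) : 0 < poch l n :=
  Finset.prod_pos fun i _ => by positivity

lemma wt_pos {l : ℝ} (hl : 0 < l) (n : ℕ) : 0 < wt l n :=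
  div_pos (by positivity) (poch_pos hl n)

lemma wt_succ {l : ℝ} (hl : 0 < l) (n : ℕ) : wt l (n + 1) = (n + 1) / (l + n) * wt l n := by
  have h := (poch_pos hl n).ne'
  have h' : l + n ≠ 0 := by positivity
  have hp : poch l (n + 1) = poch l n * (l + n) := Finset.prod_range_succ _ _
  rw [wt, wt, hp, Nat.factorial_succ]
  push_cast
  field_simp

/-- A bound for the growth factor `wt l (k + m) / wt l k`, uniform in `k`. -/
noncomputable def wtGrowth (l : ℝ) (m : ℕ) : ℝ := ∏ i ∈ Finset.range m, (1 + l⁻¹ / (i + 1))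

lemma wtGrowth_succ (l : ℝ) (m : ℕ) :
    wtGrowth l (m + 1) = wtGrowth l m * (1 + l⁻¹ / (m + 1)) :=
  Finset.prod_range_succ _ _

lemma one_le_wtGrowth {l : ℝ} (hl : 0 < l) (m : ℕ) : 1 ≤ wtGrowth l m := by
  induction m with
  | zero => simp [wtGrowth]
  | succ m ih =>
    rw [wtGrowth_succ]
    exact one_le_mul_of_one_le_of_one_le ih (le_add_of_nonneg_right (by positivity))

lemma succ_div_add_le {l : ℝ} (hl : 0 < l) (n : ℕ) :
    ((n : ℝ) + 1) / (l + n) ≤ 1 + l⁻¹ / (n + 1) := by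
  have hn : (0 : ℝ) ≤ n := n.cast_nonneg
  have h : 1 + l⁻¹ / ((n : ℝ) + 1) = (l * (n + 1) + 1) / (l * (n + 1)) := by
    field_simp
  rw [h, div_le_div_iff₀ (by positivity) (by positivity)]
  nlinarith [mul_nonneg hn (sq_nonneg (l - 1)), mul_pos hl hl]

lemma wt_add_le {l : ℝ} (hl : 0 < l) (k m : ℕ) : wt l (k + m) ≤ wtGrowth l m * wt l k := by
  induction m with
  | zero => simp [wtGrowth]
  | succ m ih =>
    have h0 := (wt_pos hl (k + m)).le
    have hr : (((k + m : ℕ) : ℝ) + 1) / (l + (k + m : ℕ)) ≤ 1 + l⁻¹ / (m + 1) := by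
      refine (succ_div_add_le hl (k + m)).trans ?_
      push_cast
      gcongr
      linarith [(k.cast_nonneg : (0 : ℝ) ≤ k)]
    rw [← add_assoc, wt_succ hl, wtGrowth_succ]
    calc _ ≤ (1 + l⁻¹ / (m + 1)) * (wtGrowth l m * wt l k) := by gcongr
      _ = _ := by ring

lemma summable_succ_mul_pow_mul_wtGrowth {l r : ℝ} (hl : 0 < l) (hr0 : 0 ≤ r) (hr : r < 1) :
    Summable fun m : ℕ => (m + 1 : ℝ) * r ^ m * wtGrowth l m := by
  rcases hr0.eq_or_lt with rfl | hr0
  · refine summable_of_ne_finset_zero (s := {0}) fun m hm => ?_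
    simp [zero_pow (by simpa using hm : m ≠ 0)]
  have hpos : ∀ m, 0 < wtGrowth l m := fun m => one_pos.trans_le (one_le_wtGrowth hl m)
  refine summable_of_ratio_test_tendsto_lt_one hr
    (Filter.Eventually.of_forall fun m => ?_) ?_
  · have := hpos m
    positivity
  · have h1 : Filter.Tendsto (fun m : ℕ => 1 / ((m : ℝ) + 1)) Filter.atTop (nhds 0) :=
      tendsto_one_div_add_atTop_nhds_zero_nat
    have h2 : Filter.Tendsto
        (fun m : ℕ => (1 + 1 / ((m : ℝ) + 1)) * r * (1 + l⁻¹ * (1 / ((m : ℝ) + 1))))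
        Filter.atTop (nhds ((1 + 0) * r * (1 + l⁻¹ * 0))) :=
      ((h1.const_add 1).mul_const r).mul ((h1.const_mul l⁻¹).const_add 1)
    rw [show (1 + 0) * r * (1 + l⁻¹ * 0) = r by ring] at h2
    refine h2.congr fun m => ?_
    have hm := hpos m
    rw [wtGrowth_succ, Real.norm_of_nonneg (by positivity), Real.norm_of_nonneg (by positivity)]
    push_cast
    field_simp
    ring

/-- Weighted Young inequality, at the level of a single coefficient of a Cauchy product. -/
lemma norm_sq_sum_antidiagonal_mul_le {w T : ℕ → ℝ} (hw : ∀ n, 0 ≤ w n) (hT : ∀ m, 1 ≤ T m)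
    (hwT : ∀ k m, w (k + m) ≤ T m * w k) (c α : ℕ → ℂ)
    (hc : Summable fun m => ‖c m‖ * T m) (n : ℕ) :
    ‖∑ p ∈ Finset.HasAntidiagonal.antidiagonal n, c p.1 * α p.2‖ ^ 2 * w n ≤
      (∑' m, ‖c m‖ * T m) *
        ∑ p ∈ Finset.HasAntidiagonal.antidiagonal n, (‖c p.1‖ * T p.1) * (‖α p.2‖ ^ 2 * w p.2) := by
  have hT0 : ∀ m, 0 ≤ T m := fun m => zero_le_one.trans (hT m)
  have hA : ∑ p ∈ Finset.HasAntidiagonal.antidiagonal n, ‖c p.1‖ ≤ ∑' m, ‖c m‖ * T m := by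
    rw [Finset.Nat.sum_antidiagonal_eq_sum_range_succ_mk]
    refine (Finset.sum_le_sum fun m _ => ?_).trans
      (hc.sum_le_tsum _ fun m _ => mul_nonneg (norm_nonneg _) (hT0 m))
    exact le_mul_of_one_le_right (norm_nonneg _) (hT m)
  have hCS : ‖∑ p ∈ Finset.HasAntidiagonal.antidiagonal n, c p.1 * α p.2‖ ^ 2 ≤
      (∑ p ∈ Finset.HasAntidiagonal.antidiagonal n, ‖c p.1‖) *
        ∑ p ∈ Finset.HasAntidiagonal.antidiagonal n, ‖c p.1‖ * ‖α p.2‖ ^ 2 := by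
    calc _ ≤ (∑ p ∈ Finset.HasAntidiagonal.antidiagonal n, ‖c p.1‖ * ‖α p.2‖) ^ 2 := by
          gcongr
          exact (norm_sum_le _ _).trans_eq (by simp)
      _ ≤ _ := Finset.sum_sq_le_sum_mul_sum_of_sq_le_mul _ (fun _ _ => norm_nonneg _)
          (fun _ _ => by positivity) fun _ _ => le_of_eq (by ring)
  calc _ ≤ ((∑ p ∈ Finset.HasAntidiagonal.antidiagonal n, ‖c p.1‖) *
        ∑ p ∈ Finset.HasAntidiagonal.antidiagonal n, ‖c p.1‖ * ‖α p.2‖ ^ 2) * w n :=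
        mul_le_mul_of_nonneg_right hCS (hw n)
    _ = (∑ p ∈ Finset.HasAntidiagonal.antidiagonal n, ‖c p.1‖) *
        ∑ p ∈ Finset.HasAntidiagonal.antidiagonal n, ‖c p.1‖ * ‖α p.2‖ ^ 2 * w n := by
        rw [mul_assoc, Finset.sum_mul _ _ (w n)]
    _ ≤ _ := by
        refine mul_le_mul hA (Finset.sum_le_sum fun p hp => ?_)
          (Finset.sum_nonneg fun p _ => mul_nonneg (by positivity) (hw n))
          (tsum_nonneg fun m => mul_nonneg (norm_nonneg _) (hT0 m))
        have h : w n ≤ T p.1 * w p.2 := by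
          rw [← Finset.HasAntidiagonal.mem_antidiagonal.mp hp, add_comm]
          exact hwT _ _
        calc _ ≤ ‖c p.1‖ * ‖α p.2‖ ^ 2 * (T p.1 * w p.2) := by gcongr
          _ = _ := by ring

/-- Weighted Young inequality for Cauchy products in `ℓ²(w)`. -/
lemma summable_and_tsum_antidiagonal_mul_le {w T : ℕ → ℝ} (hw : ∀ n, 0 ≤ w n)
    (hT : ∀ m, 1 ≤ T m) (hwT : ∀ k m, w (k + m) ≤ T m * w k) (c α : ℕ → ℂ)
    (hc : Summable fun m => ‖c m‖ * T m) (hα : Summable fun n => ‖α n‖ ^ 2 * w n) :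
    Summable (fun n => ‖∑ p ∈ Finset.HasAntidiagonal.antidiagonal n, c p.1 * α p.2‖ ^ 2 * w n) ∧
    ∑' n, ‖∑ p ∈ Finset.HasAntidiagonal.antidiagonal n, c p.1 * α p.2‖ ^ 2 * w n ≤
      (∑' m, ‖c m‖ * T m) ^ 2 * ∑' n, ‖α n‖ ^ 2 * w n := by
  have hs : Summable fun n => ∑ p ∈ Finset.HasAntidiagonal.antidiagonal n,
      (‖c p.1‖ * T p.1) * (‖α p.2‖ ^ 2 * w p.2) :=
    (summable_norm_sum_mul_antidiagonal_of_summable_norm hc.norm hα.norm).of_norm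
  have hle := norm_sq_sum_antidiagonal_mul_le hw hT hwT c α hc
  have hβ := Summable.of_nonneg_of_le (fun n => mul_nonneg (by positivity) (hw n)) hle
    (hs.mul_left _)
  refine ⟨hβ, (hβ.tsum_le_tsum hle (hs.mul_left _)).trans_eq ?_⟩
  rw [tsum_mul_left, ← tsum_mul_tsum_eq_tsum_sum_antidiagonal_of_summable_norm hc.norm hα.norm]
  ring

lemma hasSum_antidiagonal_mul_pow {c α : ℕ → ℂ} {z s t : ℂ}
    (hc : HasSum (fun n => c n * z ^ n) s) (hα : HasSum (fun n => α n * z ^ n) t) :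
    HasSum (fun n => (∑ p ∈ Finset.HasAntidiagonal.antidiagonal n, c p.1 * α p.2) * z ^ n) (s * t) := by
  have hcn := hc.summable.norm
  have hαn := hα.summable.norm
  have h := (summable_norm_sum_mul_antidiagonal_of_summable_norm hcn hαn).of_norm.hasSum
  rw [← tsum_mul_tsum_eq_tsum_sum_antidiagonal_of_summable_norm hcn hαn, hc.tsum_eq,
    hα.tsum_eq] at h
  have heq (n : ℕ) : (∑ p ∈ Finset.HasAntidiagonal.antidiagonal n, c p.1 * α p.2) * z ^ n =
      ∑ p ∈ Finset.HasAntidiagonal.antidiagonal n, c p.1 * z ^ p.1 * (α p.2 * z ^ p.2) := by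
    rw [Finset.sum_mul]
    refine Finset.sum_congr rfl fun p hp => ?_
    rw [← Finset.HasAntidiagonal.mem_antidiagonal.mp hp, pow_add]
    ring
  simpa only [heq] using h

/-- Let `λ > 0` and `a ∈ 𝔻`. Then `z ↦ (1 − ā z)^{−2}` is a multiplier of
`H^{(λ)}`: there is `C > 0` such that for every `f ∈ H^{(λ)}` the function
`z ↦ (1 − ā z)^{−2} f(z)` belongs to `H^{(λ)}` with norm at most `C ‖f‖_{H^{(λ)}}`. -/
theorem stmt_16 (l : ℝ) (hl : 0 < l) (a : ℂ) (ha : a ∈ ball (0 : ℂ) 1) :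
    ∃ C : ℝ, 0 < C ∧ ∀ (f : ℂ → ℂ) (α : ℕ → ℂ),
      (∀ z ∈ ball (0 : ℂ) 1, HasSum (fun n => α n * z ^ n) (f z)) →
      Summable (fun n => ‖α n‖ ^ 2 * wt l n) →
      ∃ β : ℕ → ℂ,
        (∀ z ∈ ball (0 : ℂ) 1,
          HasSum (fun n => β n * z ^ n) (((1 - (starRingEnd ℂ) a * z) ^ 2)⁻¹ * f z)) ∧
        Summable (fun n => ‖β n‖ ^ 2 * wt l n) ∧
        ∑' n, ‖β n‖ ^ 2 * wt l n ≤ C ^ 2 * ∑' n, ‖α n‖ ^ 2 * wt l n := by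
  set b : ℂ := (starRingEnd ℂ) a with hb
  have hb1 : ‖b‖ < 1 := by simpa [hb] using ha
  set c : ℕ → ℂ := fun m => (m + 1) * b ^ m with hc
  have hcs : Summable fun m => ‖c m‖ * wtGrowth l m := by
    refine (summable_succ_mul_pow_mul_wtGrowth hl (norm_nonneg b) hb1).congr fun m => ?_
    have hm : ‖(m : ℂ) + 1‖ = m + 1 := by
      rw [← Nat.cast_succ, Complex.norm_natCast, Nat.cast_succ]
    rw [hc, norm_mul, norm_pow, hm]
  have hA : 0 < ∑' m, ‖c m‖ * wtGrowth l m := by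
    refine hcs.tsum_pos (fun m => mul_nonneg (norm_nonneg _)
      (zero_le_one.trans (one_le_wtGrowth hl m))) 0 ?_
    simp [hc, wtGrowth]
  refine ⟨_, hA, fun f α hf hα => ⟨fun n => ∑ p ∈ Finset.HasAntidiagonal.antidiagonal n, c p.1 * α p.2,
    fun z hz => hasSum_antidiagonal_mul_pow ?_ (hf z hz),
    summable_and_tsum_antidiagonal_mul_le (fun n => (wt_pos hl n).le) (one_le_wtGrowth hl)
      (wt_add_le hl) c α hcs hα⟩⟩
  have hz1 : ‖z‖ < 1 := by simpa using hz
  have hbz : ‖b * z‖ < 1 := by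
    rw [norm_mul]
    exact mul_lt_one_of_nonneg_of_lt_one_left (norm_nonneg _) hb1 hz1.le
  have h := hasSum_choose_mul_geometric_of_norm_lt_one 1 hbz
  rw [one_div] at h
  simpa [hc, mul_pow, mul_assoc] using h
end
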